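/- Let 0 ≤ e ≤ h−1, let C_1,…,C_s ⊆ F_q^n be linear codes, and let A be a non-singular s×s matrix over F_q. Let M_{τ'} be an n×n monomial matrix, M̂ an s×s monomial matrix, and set M_τ = M̂ ⊗ M_{τ'}; let σ = (M_τ, e) on F_q^{sn} and σ' = (M_{τ'}, e) on F_q^n. Then C(A)^{⊥σ} = [C_1^{⊥σ'}, C_2^{⊥σ'}, …, C_s^{⊥σ'}]·(M̂^T·π_e(A)^T)^{-1}, where C(A) = [C_1,…,C_s]·A. -/

import Mathlib

open Matrix Finset Kronecker

variable {F : Type} [Field F] [DecidableEq F]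

/-- Entrywise application of the map `π_e : x ↦ x ^ (p ^ e)` to a matrix. -/
def piE (p e : ℕ) {m n : Type} (A : Matrix m n F) : Matrix m n F :=
  A.map fun x => x ^ p ^ e

/-- Entrywise application of `π_e` to a vector. -/
def piEv (p e : ℕ) {n : Type} (v : n → F) : n → F := fun i => v i ^ p ^ e

/-- A monomial matrix: exactly one nonzero entry in each row and each column. -/
def IsMonomial {n : Type} [Fintype n] (M : Matrix n n F) : Prop :=
  (∀ i, ∃! j, M i j ≠ 0) ∧ (∀ j, ∃! i, M i j ≠ 0)

/-- Non-singular by columns (NSC): for each `ℓ`, every `ℓ × ℓ` submatrix formed by the first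
`ℓ` rows and any `ℓ` columns (in increasing order) is non-singular. -/
def IsNSC {s : ℕ} (A : Matrix (Fin s) (Fin s) F) : Prop :=
  ∀ (ℓ : ℕ) (hℓ : ℓ ≤ s) (j : Fin ℓ → Fin s), StrictMono j →
    (Matrix.of fun a b : Fin ℓ => A (Fin.castLE hℓ a) (j b)).det ≠ 0

/-- Toeplitz matrix: constant along diagonals. -/
def IsToeplitz {s : ℕ} (A : Matrix (Fin s) (Fin s) F) : Prop :=
  ∀ (i j : ℕ) (hi : i + 1 < s) (hj : j + 1 < s),
    A ⟨i, Nat.lt_of_succ_lt hi⟩ ⟨j, Nat.lt_of_succ_lt hj⟩ = A ⟨i + 1, hi⟩ ⟨j + 1, hj⟩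

/-- The anti-diagonal matrix `Q` with ones on the anti-diagonal. -/
def antiDiagQ (F : Type) [Field F] (s : ℕ) : Matrix (Fin s) (Fin s) F :=
  Matrix.of fun i j => if (i : ℕ) + (j : ℕ) + 1 = s then 1 else 0

/-- Dual of a code with respect to the pairing `⟨u, c⟩ = ∑ j, u j * g c j`. -/
def dualWith {n : Type} [Fintype n] (g : (n → F) → n → F) (C : Submodule F (n → F)) :
    Submodule F (n → F) where
  carrier := {u | ∀ c ∈ C, ∑ j, u j * g c j = 0}
  add_mem' := by
    intro a b ha hb c hc
    simp only [Pi.add_apply, add_mul, Finset.sum_add_distrib, ha c hc, hb c hc, add_zero]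
  zero_mem' := by
    intro c hc
    simp
  smul_mem' := by
    intro r a ha c hc
    simp only [Pi.smul_apply, smul_eq_mul, mul_assoc, ← Finset.mul_sum, ha c hc, mul_zero]

/-- The `σ = (M, e)` dual of a linear code. -/
def sigmaDual {n : Type} [Fintype n] (p e : ℕ) (M : Matrix n n F)
    (C : Submodule F (n → F)) : Submodule F (n → F) :=
  dualWith (fun c => Matrix.vecMul (piEv p e c) M) C

/-- The Euclidean dual of a linear code. -/
def euclidDual {n : Type} [Fintype n] (C : Submodule F (n → F)) : Submodule F (n → F) :=
  dualWith id C

/-- The matrix-product code `[C_1, …, C_s] · A`, realized inside `Fin s × Fin n → F`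
(block `j` of a codeword is `∑ i, A i j • c i`). -/
def matrixProductCode {n s : ℕ} (C : Fin s → Submodule F (Fin n → F))
    (A : Matrix (Fin s) (Fin s) F) : Submodule F (Fin s × Fin n → F) where
  carrier := {x | ∃ c : Fin s → Fin n → F, (∀ i, c i ∈ C i) ∧
    ∀ jt : Fin s × Fin n, x jt = ∑ i, A i jt.1 * c i jt.2}
  add_mem' := by
    rintro x y ⟨c, hc, hx⟩ ⟨d, hd, hy⟩
    refine ⟨c + d, fun i => (C i).add_mem (hc i) (hd i), fun jt => ?_⟩
    simp [hx jt, hy jt, mul_add, Finset.sum_add_distrib]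
  zero_mem' := ⟨0, fun i => (C i).zero_mem, fun jt => by simp⟩
  smul_mem' := by
    rintro r x ⟨c, hc, hx⟩
    refine ⟨r • c, fun i => (C i).smul_mem r (hc i), fun jt => ?_⟩
    simp [hx jt, Finset.mul_sum, mul_left_comm]

/-- The minimum distance of the code `C` is at least `d`. -/
def minDistGe {n : Type} [Fintype n] (C : Submodule F (n → F)) (d : ℕ) : Prop :=
  ∀ x ∈ C, x ≠ 0 → d ≤ hammingNorm x

/-- The code `C` has minimum distance exactly `d`. -/
def minDistEq {n : Type} [Fintype n] (C : Submodule F (n → F)) (d : ℕ) : Prop :=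
  minDistGe C d ∧ ∃ x ∈ C, x ≠ 0 ∧ hammingNorm x = d

theorem IsMonomial.isUnit_det {m : Type} [Fintype m] [DecidableEq m] {M : Matrix m m F}
    (hM : IsMonomial M) : IsUnit M.det := by
  rw [isUnit_iff_ne_zero]
  intro hdet
  obtain ⟨v, hv, hvM⟩ := Matrix.exists_vecMul_eq_zero_iff.2 hdet
  refine hv (funext fun i => ?_)
  obtain ⟨j, hj, -⟩ := hM.1 i
  have hcol : (v ᵥ* M) j = v i * M i j :=
    Finset.sum_eq_single i
      (fun k _ hk => by
        have : M k j = 0 := by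
          by_contra hne
          exact hk ((hM.2 j).unique hne hj)
        simp [this])
      (by simp)
  rw [hvM, Pi.zero_apply, eq_comm, mul_eq_zero] at hcol
  exact hcol.resolve_right hj

theorem isUnit_det_piE {p : ℕ} [ExpChar F p] (e : ℕ) {m : Type} [Fintype m] [DecidableEq m]
    {A : Matrix m m F} (hA : IsUnit A.det) : IsUnit (piE p e A).det := by
  change IsUnit ((iterateFrobenius F p e).mapMatrix A).det
  rw [← RingHom.map_det]
  exact hA.map _

theorem mem_matrixProductCode {n s : ℕ} {C : Fin s → Submodule F (Fin n → F)}
    {A : Matrix (Fin s) (Fin s) F} {x : Fin s × Fin n → F} :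
    x ∈ matrixProductCode C A ↔ ∃ c : Matrix (Fin s) (Fin n) F, (∀ i, c i ∈ C i) ∧
      Matrix.of (fun j t => x (j, t)) = Aᵀ * c := by
  refine exists_congr fun c => and_congr_right fun _ => ?_
  rw [← Matrix.ext_iff, Prod.forall]
  rfl

/-- Membership in a matrix-product code whose defining matrix is an inverse. -/
theorem mem_matrixProductCode_inv {n s : ℕ} {C : Fin s → Submodule F (Fin n → F)}
    {B : Matrix (Fin s) (Fin s) F} (hB : IsUnit B.det) {x : Fin s × Fin n → F} :
    x ∈ matrixProductCode C B⁻¹ ↔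
      ∀ i, (Bᵀ * Matrix.of fun j t => x (j, t)) i ∈ C i := by
  have hBT : IsUnit Bᵀ.det := by rwa [Matrix.det_transpose]
  rw [mem_matrixProductCode, Matrix.transpose_nonsing_inv]
  constructor
  · rintro ⟨c, hc, hx⟩
    rwa [hx, Matrix.mul_nonsing_inv_cancel_left _ _ hBT]
  · intro hx
    exact ⟨_, hx, (Matrix.nonsing_inv_mul_cancel_left _ _ hBT).symm⟩

/-- The `σ` inner product with a codeword of a matrix-product code splits over the blocks. -/
theorem dotProduct_vecMul_kronecker {p : ℕ} [ExpChar F p] (e : ℕ) {n s : ℕ}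
    (A Mhat : Matrix (Fin s) (Fin s) F) (M : Matrix (Fin n) (Fin n) F)
    (u : Fin s × Fin n → F) (c : Fin s → Fin n → F) :
    u ⬝ᵥ (piEv p e (fun jt : Fin s × Fin n => ∑ i, A i jt.1 * c i jt.2) ᵥ* (Mhat ⊗ₖ M)) =
      ∑ i, (piE p e A * Mhat * Matrix.of fun j t => u (j, t)) i ⬝ᵥ (piEv p e (c i) ᵥ* M) := by
  set U : Matrix (Fin s) (Fin n) F := Matrix.of fun j t => u (j, t)
  set c' : Matrix (Fin s) (Fin n) F := Matrix.of fun i => piEv p e (c i)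
  have hpi : piEv p e (fun jt : Fin s × Fin n => ∑ i, A i jt.1 * c i jt.2) =
      fun jt => ((piE p e A)ᵀ * c') jt.1 jt.2 := by
    funext jt
    change iterateFrobenius F p e _ =
      ∑ i, iterateFrobenius F p e (A i jt.1) * iterateFrobenius F p e (c i jt.2)
    simp
  have hvec (X : Matrix (Fin s) (Fin n) F) (j : Fin s) (t : Fin n) :
      ((fun jt : Fin s × Fin n => X jt.1 jt.2) ᵥ* (Mhat ⊗ₖ M)) (j, t) = (Mhatᵀ * (X * M)) j t := by
    simp only [vecMul, dotProduct, Matrix.mul_apply, kroneckerMap_apply, transpose_apply,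
      Fintype.sum_prod_type, Finset.mul_sum]
    exact Finset.sum_congr rfl fun _ _ => Finset.sum_congr rfl fun _ _ => by ring
  have htrace (X Y : Matrix (Fin s) (Fin n) F) : ∑ i, X i ⬝ᵥ Y i = (Xᵀ * Y).trace := by
    simp only [dotProduct, Matrix.trace, Matrix.diag, Matrix.mul_apply, transpose_apply]
    exact Finset.sum_comm
  calc
    _ = ∑ j, U j ⬝ᵥ (Mhatᵀ * ((piE p e A)ᵀ * c' * M)) j := by
      rw [hpi, dotProduct, Fintype.sum_prod_type]
      simp only [hvec]
      rfl
    _ = ∑ i, (piE p e A * Mhat * U) i ⬝ᵥ (c' * M) i := by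
      rw [htrace, htrace]
      simp only [transpose_mul, Matrix.mul_assoc]
    _ = _ := rfl

theorem mem_sigmaDual_matrixProductCode {p : ℕ} (hp : p ≠ 0) [ExpChar F p] (e : ℕ) {n s : ℕ}
    (C : Fin s → Submodule F (Fin n → F)) (A Mhat : Matrix (Fin s) (Fin s) F)
    (M : Matrix (Fin n) (Fin n) F) (u : Fin s × Fin n → F) :
    u ∈ sigmaDual p e (Mhat ⊗ₖ M) (matrixProductCode C A) ↔
      ∀ i, (piE p e A * Mhat * Matrix.of fun j t => u (j, t)) i ∈ sigmaDual p e M (C i) := by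
  constructor
  · intro hu i c hc
    have key := dotProduct_vecMul_kronecker (p := p) e A Mhat M u (Pi.single i c)
    rw [Finset.sum_eq_single i] at key
    · rw [Pi.single_eq_same] at key
      refine key.symm.trans (hu _ ⟨Pi.single i c, fun k => ?_, fun _ => rfl⟩)
      obtain rfl | hk := eq_or_ne k i
      · rwa [Pi.single_eq_same]
      · rw [Pi.single_eq_of_ne hk]
        exact zero_mem _
    · intro k _ hk
      have hzero : piEv p e (0 : Fin n → F) = 0 := funext fun _ => zero_pow (pow_ne_zero _ hp)
      rw [Pi.single_eq_of_ne hk, hzero, Matrix.zero_vecMul, dotProduct_zero]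
    · simp
  · rintro hu x ⟨c, hc, hx⟩
    obtain rfl := funext hx
    exact (dotProduct_vecMul_kronecker e A Mhat M u c).trans
      (Finset.sum_eq_zero fun i _ => hu i _ (hc i))

/-- the `σ` dual of a matrix-product code, `σ = (M̂ ⊗ M_{τ'}, e)`:
`C(A)^{⊥σ} = [C_1^{⊥σ'}, …, C_s^{⊥σ'}] · (M̂ᵀ·π_e(A)ᵀ)⁻¹`. -/
theorem stmt17 {p h : ℕ} (hp : p.Prime) (hh : 0 < h)
    {F : Type} [Field F] [Fintype F] [DecidableEq F] (hcard : Fintype.card F = p ^ h)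
    (e : ℕ) (he : e < h)
    {n s : ℕ} (C : Fin s → Submodule F (Fin n → F))
    (A : Matrix (Fin s) (Fin s) F) (hAdet : IsUnit A.det)
    (Mτ' : Matrix (Fin n) (Fin n) F) (hMτ' : IsMonomial Mτ')
    (Mhat : Matrix (Fin s) (Fin s) F) (hMhat : IsMonomial Mhat) :
    sigmaDual p e (Mhat ⊗ₖ Mτ') (matrixProductCode C A) =
      matrixProductCode (fun i => sigmaDual p e Mτ' (C i))
        ((Mhatᵀ * (piE p e A)ᵀ)⁻¹) := by
  have : Fact p.Prime := ⟨hp⟩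
  have : CharP F p := charP_of_card_eq_prime_pow hcard
  have : ExpChar F p := .prime hp
  have hdet : IsUnit (Mhatᵀ * (piE p e A)ᵀ).det := by
    rw [Matrix.det_mul, Matrix.det_transpose, Matrix.det_transpose]
    exact hMhat.isUnit_det.mul (isUnit_det_piE e hAdet)
  ext u
  rw [mem_sigmaDual_matrixProductCode hp.ne_zero, mem_matrixProductCode_inv hdet,
    Matrix.transpose_mul, Matrix.transpose_transpose, Matrix.transpose_transpose]
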